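/- Let V be a complex vector space, ω = (ω_n)_{n≥1} a family of n-point functionals on V (with the convention ω_0 := 1), and (ω^T_n)_{n≥1} a family of truncated functionals for ω. If ω^T_n = 0 for every n ≥ 1 with n ≠ 2 (i.e. ω is quasi-free), then ω satisfies scalar commutation relations. -/

import Mathlib

open scoped BigOperators

/-- `(ωT n)` is a family of truncated functionals for `(ω n)`: for every `n ≥ 1`,
`ω_n(f_n,…,f_1) = ∑_P ∏_{r ∈ P} ω^T_{|r|}(f_{r(|r|)},…,f_{r(1)})`, where `P` runs over
all partitions of `{1,…,n}` into nonempty blocks, each block listed in increasing order.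
(Here the multilinear map index `j : Fin n` corresponds to the argument `f_{j+1}`.) -/
def IsTruncatedFamily {V : Type*} [AddCommGroup V] [Module ℂ V]
    (ω ωT : ∀ n, MultilinearMap ℂ (fun _ : Fin n => V) ℂ) : Prop :=
  ∀ (n : ℕ) (f : Fin (n + 1) → V),
    ω (n + 1) f =
      ∑ P : Finpartition (Finset.univ : Finset (Fin (n + 1))),
        ∏ r ∈ P.parts, ωT r.card (fun j => f (r.orderIsoOfFin rfl j))

/-- The function obtained from `g : Fin (n+2) → V` by omitting the arguments at the
two consecutive positions `p` and `p+1`. -/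
def omitTwo {V : Type*} {n : ℕ} (g : Fin (n + 2) → V) (p : Fin (n + 1)) : Fin n → V :=
  fun j => if (j : ℕ) < (p : ℕ) then g ⟨j, by omega⟩ else g ⟨(j : ℕ) + 2, by omega⟩

/-- `ω` satisfies scalar commutation relations: for every `n ≥ 2` and `1 ≤ i < n`,
`ω_n(f_n,…,f_{i+1},f_i,…,f_1) − ω_n(f_n,…,f_i,f_{i+1},…,f_1)
  = (ω_2(f_{i+1},f_i) − ω_2(f_i,f_{i+1})) · ω_{n−2}(f_n,…,f_{i+2},f_{i−1},…,f_1)`.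
(Positions are `0`-based: `p = i − 1`, and the index `j : Fin n` is the argument
`f_{j+1}`.) -/
def SatisfiesScalarCommutationRelations {V : Type*} [AddCommGroup V] [Module ℂ V]
    (ω : ∀ n, MultilinearMap ℂ (fun _ : Fin n => V) ℂ) : Prop :=
  ∀ (n : ℕ) (p : Fin (n + 1)) (g : Fin (n + 2) → V),
    ω (n + 2) g - ω (n + 2) (g ∘ Equiv.swap p.castSucc p.succ) =
      (ω 2 ![g p.castSucc, g p.succ] - ω 2 ![g p.succ, g p.castSucc]) * ω n (omitTwo g p)

/-- The contribution of a block `r` to the expansion in truncated functionals. -/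
noncomputable def blockValue {V : Type*} [AddCommGroup V] [Module ℂ V]
    (ωT : ∀ n, MultilinearMap ℂ (fun _ : Fin n => V) ℂ) {α : Type*} [LinearOrder α]
    (g : α → V) (r : Finset α) : ℂ :=
  ωT r.card (fun j => g (r.orderEmbOfFin rfl j))

section blockValue

variable {V : Type*} [AddCommGroup V] [Module ℂ V]
  (ωT : ∀ n, MultilinearMap ℂ (fun _ : Fin n => V) ℂ)
  {α β : Type*} [LinearOrder α] [LinearOrder β]

theorem blockValue_eq_of_strictMono (g : α → V) (r : Finset α) {k : ℕ} (hk : r.card = k)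
    (f : Fin k → α) (hf : ∀ j, f j ∈ r) (hmono : StrictMono f) :
    blockValue ωT g r = ωT k (g ∘ f) := by
  subst hk
  rw [Finset.orderEmbOfFin_unique rfl hf hmono]
  rfl

theorem blockValue_map (g : β → V) (e : α ↪ β) (r : Finset α) (he : StrictMonoOn e r) :
    blockValue ωT g (r.map e) = blockValue ωT (g ∘ e) r :=
  blockValue_eq_of_strictMono ωT g (r.map e) (Finset.card_map e)
    (fun j => e (r.orderEmbOfFin rfl j)) (by simp)
    (fun _ _ h => he (by simp) (by simp) ((r.orderEmbOfFin rfl).strictMono h))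

theorem blockValue_pair (g : α → V) {a b : α} (hab : a < b) :
    blockValue ωT g {a, b} = ωT 2 ![g a, g b] := by
  rw [blockValue_eq_of_strictMono ωT g {a, b} (Finset.card_pair hab.ne) ![a, b]
    (by simp [Fin.forall_fin_two]) (by simp [Fin.strictMono_iff_lt_succ, hab])]
  congr 1
  ext j
  fin_cases j <;> rfl

theorem blockValue_eq_zero (hqf : ∀ n : ℕ, 1 ≤ n → n ≠ 2 → ωT n = 0) (g : α → V)
    {r : Finset α} (hr : r.Nonempty) (hr2 : r.card ≠ 2) : blockValue ωT g r = 0 := by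
  rw [blockValue, hqf _ hr.card_pos hr2]
  rfl

/-- The sum over all partitions, including the case of no arguments. -/
theorem IsTruncatedFamily.eq_sum_blockValue
    {ω ωT : ∀ n, MultilinearMap ℂ (fun _ : Fin n => V) ℂ}
    (htr : IsTruncatedFamily ω ωT) (hω0 : ∀ v : Fin 0 → V, ω 0 v = 1) (n : ℕ) (g : Fin n → V) :
    ω n g = ∑ P : Finpartition (Finset.univ : Finset (Fin n)),
      ∏ r ∈ P.parts, blockValue ωT g r := by
  cases n with
  | zero =>
    have hparts (P : Finpartition (Finset.univ : Finset (Fin 0))) : P.parts = ∅ :=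
      Finset.eq_empty_of_forall_notMem fun r hr =>
        (P.nonempty_of_mem_parts hr).elim fun x _ => x.elim0
    have : Unique (Finpartition (Finset.univ : Finset (Fin 0))) :=
      { default := ⊥, uniq := fun P => Finpartition.ext ((hparts P).trans (hparts ⊥).symm) }
    rw [hω0, Fintype.sum_unique, hparts, Finset.prod_empty]
  | succ n => exact htr n g

end blockValue

namespace Finpartition

theorem notMem_image_map {α β : Type*} [DecidableEq β] (e : α ↪ β) (s : Finset β)
    (hs : s.Nonempty) (hse : ∀ x, x ∈ s ↔ x ∉ Set.range e)
    (A : Finset (Finset α)) : s ∉ A.image (Finset.map e) := by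
  intro h
  obtain ⟨r, -, rfl⟩ := Finset.mem_image.1 h
  obtain ⟨x, hx⟩ := hs
  obtain ⟨y, -, rfl⟩ := Finset.mem_map.1 hx
  exact (hse _).1 hx ⟨y, rfl⟩

variable {α β : Type*} [Fintype α] [Fintype β] [DecidableEq α] [DecidableEq β]

/-- Push a partition forward along an injection and add the complement of its range as a block. -/
def adjoinCompl (e : α ↪ β) (s : Finset β) (hs : s.Nonempty) (hse : ∀ x, x ∈ s ↔ x ∉ Set.range e)
    (P : Finpartition (Finset.univ : Finset α)) : Finpartition (Finset.univ : Finset β) :=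
  ofExistsUnique (insert s (P.parts.image (Finset.map e))) (fun _ _ => Finset.subset_univ _)
    (by
      intro x _
      by_cases hx : x ∈ s
      · refine ⟨s, ⟨Finset.mem_insert_self _ _, hx⟩, ?_⟩
        rintro t ⟨ht, hxt⟩
        obtain rfl | ht := Finset.mem_insert.1 ht
        · rfl
        · obtain ⟨r, -, rfl⟩ := Finset.mem_image.1 ht
          obtain ⟨y, -, rfl⟩ := Finset.mem_map.1 hxt
          exact absurd ⟨y, rfl⟩ ((hse _).1 hx)
      · obtain ⟨y, rfl⟩ := not_not.1 (mt (hse x).2 hx)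
        obtain ⟨r, ⟨hr, hyr⟩, huniq⟩ := P.existsUnique_mem (Finset.mem_univ y)
        refine ⟨r.map e, ⟨Finset.mem_insert_of_mem (Finset.mem_image_of_mem _ hr),
          Finset.mem_map_of_mem e hyr⟩, ?_⟩
        rintro t ⟨ht, hxt⟩
        obtain rfl | ht := Finset.mem_insert.1 ht
        · exact absurd hxt hx
        · obtain ⟨q, hq, rfl⟩ := Finset.mem_image.1 ht
          rw [huniq q ⟨hq, (Finset.mem_map' e).1 hxt⟩])
    (by
      intro h
      obtain h | h := Finset.mem_insert.1 h
      · exact hs.ne_empty h.symm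
      · obtain ⟨r, hr, h⟩ := Finset.mem_image.1 h
        exact (P.nonempty_of_mem_parts hr).ne_empty (Finset.map_eq_empty.1 h))

variable (e : α ↪ β) (s : Finset β) (hs : s.Nonempty) (hse : ∀ x, x ∈ s ↔ x ∉ Set.range e)

theorem adjoinCompl_parts (P : Finpartition (Finset.univ : Finset α)) :
    (adjoinCompl e s hs hse P).parts = insert s (P.parts.image (Finset.map e)) := rfl

theorem adjoinCompl_injective : Function.Injective (adjoinCompl e s hs hse) := by
  intro P Q h
  have h' := congrArg (fun R => R.parts.erase s) h
  simp only [adjoinCompl_parts,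
    Finset.erase_insert (notMem_image_map e s hs hse _)] at h'
  exact Finpartition.ext (Finset.image_injective (Finset.map_injective e) h')

theorem exists_adjoinCompl_eq (P : Finpartition (Finset.univ : Finset β)) (hP : s ∈ P.parts) :
    ∃ Q, adjoinCompl e s hs hse Q = P := by
  have hmap (r) (hr : r ∈ P.parts.erase s) : (Finset.univ.filter (e · ∈ r)).map e = r := by
    obtain ⟨hrs, hr⟩ := Finset.mem_erase.1 hr
    ext x
    simp only [Finset.mem_map, Finset.mem_filter, Finset.mem_univ, true_and]
    refine ⟨by rintro ⟨y, hy, rfl⟩; exact hy, fun hx => ?_⟩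
    have hxs : x ∉ s := fun hxs => hrs (P.eq_of_mem_parts hr hP hx hxs)
    obtain ⟨y, rfl⟩ := not_not.1 (mt (hse x).2 hxs)
    exact ⟨y, hx, rfl⟩
  refine ⟨ofExistsUnique ((P.parts.erase s).image fun r => Finset.univ.filter (e · ∈ r))
    (fun _ _ => Finset.subset_univ _) ?_ ?_, ?_⟩
  · intro y _
    obtain ⟨r, ⟨hr, hyr⟩, huniq⟩ := P.existsUnique_mem (Finset.mem_univ (e y))
    have hrs : r ≠ s := by
      rintro rfl
      exact (hse _).1 hyr ⟨y, rfl⟩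
    refine ⟨_, ⟨Finset.mem_image_of_mem _ (Finset.mem_erase.2 ⟨hrs, hr⟩), by simpa using hyr⟩, ?_⟩
    rintro t ⟨ht, hyt⟩
    obtain ⟨q, hq, rfl⟩ := Finset.mem_image.1 ht
    rw [huniq q ⟨Finset.mem_of_mem_erase hq, (Finset.mem_filter.1 hyt).2⟩]
  · intro h
    obtain ⟨r, hr, h⟩ := Finset.mem_image.1 h
    have hr' := hmap r hr
    rw [h, Finset.map_empty] at hr'
    exact (P.nonempty_of_mem_parts (Finset.mem_of_mem_erase hr)).ne_empty hr'.symm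
  · apply Finpartition.ext
    rw [adjoinCompl_parts, ofExistsUnique_parts, Finset.image_image,
      Finset.image_congr (f := Finset.map e ∘ _) (g := id) (fun r hr => hmap r (Finset.mem_coe.1 hr)), Finset.image_id,
      Finset.insert_erase hP]

/-- The part of a partition sum in which a given block occurs. -/
theorem sum_filter_mem_parts_prod {M : Type*} [CommSemiring M] (w : Finset β → M)
    (hs : s.Nonempty) (hse : ∀ x, x ∈ s ↔ x ∉ Set.range e) :
    ∑ P : Finpartition (Finset.univ : Finset β) with s ∈ P.parts, ∏ r ∈ P.parts, w r =
      w s * ∑ Q : Finpartition (Finset.univ : Finset α), ∏ r ∈ Q.parts, w (r.map e) := by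
  rw [Finset.mul_sum]
  symm
  refine Finset.sum_bij (fun Q _ => adjoinCompl e s hs hse Q) ?_ ?_ ?_ ?_
  · intro Q _
    simp [adjoinCompl_parts]
  · intro P _ Q _ h
    exact adjoinCompl_injective e s hs hse h
  · intro P hP
    obtain ⟨Q, hQ⟩ := exists_adjoinCompl_eq e s hs hse P (Finset.mem_filter.1 hP).2
    exact ⟨Q, Finset.mem_univ _, hQ⟩
  · intro Q _
    rw [adjoinCompl_parts, Finset.prod_insert (notMem_image_map e s hs hse _),
      Finset.prod_image (Finset.map_injective e).injOn]

/-- The image of a partition of a finite type under a permutation. -/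
def permute (σ : Equiv.Perm α) (P : Finpartition (Finset.univ : Finset α)) :
    Finpartition (Finset.univ : Finset α) :=
  (P.map (e := { toEquiv := σ.finsetCongr, map_rel_iff' := Finset.map_subset_map })).copy
    (Finset.map_univ_equiv σ)

theorem permute_parts (σ : Equiv.Perm α) (P : Finpartition (Finset.univ : Finset α)) :
    (permute σ P).parts = P.parts.map σ.finsetCongr.toEmbedding := rfl

theorem permute_permute_of_involutive {σ : Equiv.Perm α} (hσ : Function.Involutive σ)
    (P : Finpartition (Finset.univ : Finset α)) : permute σ (permute σ P) = P := by
  apply Finpartition.ext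
  have : σ.trans σ = Equiv.refl α := Equiv.ext hσ
  rw [permute_parts, permute_parts, Finset.map_map, ← Equiv.trans_toEmbedding,
    Equiv.finsetCongr_trans, this, Equiv.finsetCongr_refl]
  exact Finset.map_refl

end Finpartition

/-- The order embedding whose range omits the positions `p` and `p + 1`. -/
def skipTwo {n : ℕ} (p : Fin (n + 1)) : Fin n ↪ Fin (n + 2) where
  toFun j := if (j : ℕ) < (p : ℕ) then ⟨j, by omega⟩ else ⟨(j : ℕ) + 2, by omega⟩
  inj' i j h := by
    simp only [Fin.ext_iff] at h ⊢
    split_ifs at h <;> simp at h <;> omega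

theorem val_skipTwo {n : ℕ} (p : Fin (n + 1)) (j : Fin n) :
    (skipTwo p j : ℕ) = if (j : ℕ) < (p : ℕ) then (j : ℕ) else (j : ℕ) + 2 := by
  change ((if (j : ℕ) < (p : ℕ) then ⟨j, _⟩ else ⟨(j : ℕ) + 2, _⟩ : Fin (n + 2)) : ℕ) = _
  split_ifs <;> rfl

theorem skipTwo_strictMono {n : ℕ} (p : Fin (n + 1)) : StrictMono (skipTwo p) := by
  intro i j h
  simp only [Fin.lt_def, val_skipTwo] at h ⊢
  split_ifs <;> omega

theorem omitTwo_eq_comp_skipTwo {V : Type*} {n : ℕ} (g : Fin (n + 2) → V) (p : Fin (n + 1)) :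
    omitTwo g p = g ∘ skipTwo p := by
  ext j
  exact (apply_ite g _ _ _).symm

theorem mem_pair_iff_notMem_range_skipTwo {n : ℕ} (p : Fin (n + 1)) (x : Fin (n + 2)) :
    x ∈ ({p.castSucc, p.succ} : Finset (Fin (n + 2))) ↔ x ∉ Set.range (skipTwo p) := by
  simp only [Finset.mem_insert, Finset.mem_singleton, Set.mem_range, not_exists, Fin.ext_iff,
    Fin.val_castSucc, Fin.val_succ, val_skipTwo]
  constructor
  · intro h j
    split_ifs <;> omega
  · intro h
    by_contra! hx
    by_cases hlt : (x : ℕ) < p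
    · refine h ⟨x, by omega⟩ ?_
      simp [hlt]
    · refine h ⟨x - 2, by omega⟩ ?_
      split_ifs <;> simp_all <;> omega

theorem strictMonoOn_swap_castSucc_succ {n : ℕ} (p : Fin (n + 1)) {r : Set (Fin (n + 2))}
    (hr : ¬(p.castSucc ∈ r ∧ p.succ ∈ r)) :
    StrictMonoOn (Equiv.swap p.castSucc p.succ) r := by
  intro a ha b hb hab
  have hne : ¬(a = p.castSucc ∧ b = p.succ) := by
    rintro ⟨rfl, rfl⟩
    exact hr ⟨ha, hb⟩
  simp only [Equiv.swap_apply_def, Fin.ext_iff, Fin.lt_def, Fin.val_castSucc, Fin.val_succ]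
    at hab hne ⊢
  split_ifs <;> simp <;> omega

section quasifree

variable {V : Type*} [AddCommGroup V] [Module ℂ V]
  {ω ωT : ∀ n, MultilinearMap ℂ (fun _ : Fin n => V) ℂ}

theorem blockValue_comp_swap (hqf : ∀ n : ℕ, 1 ≤ n → n ≠ 2 → ωT n = 0) {n : ℕ}
    (p : Fin (n + 1)) (g : Fin (n + 2) → V) {r : Finset (Fin (n + 2))}
    (hr : r ≠ {p.castSucc, p.succ}) :
    blockValue ωT (g ∘ Equiv.swap p.castSucc p.succ) r =
      blockValue ωT g (r.map (Equiv.swap p.castSucc p.succ).toEmbedding) := by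
  by_cases hmem : p.castSucc ∈ r ∧ p.succ ∈ r
  · have hcard : r.card ≠ 2 := by
      intro h
      refine hr (Finset.eq_of_subset_of_card_le ?_ ?_).symm
      · simp [Finset.insert_subset_iff, hmem]
      · rw [h, Finset.card_pair (Fin.castSucc_lt_succ).ne]
    have hne : r.Nonempty := ⟨_, hmem.1⟩
    rw [blockValue_eq_zero ωT hqf _ hne hcard,
      blockValue_eq_zero ωT hqf _ (hne.map) (by rwa [Finset.card_map])]
  · exact (blockValue_map ωT g (Equiv.toEmbedding _) r (strictMonoOn_swap_castSucc_succ p hmem)).symm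

theorem sum_filter_notMem_parts_comp_swap (hqf : ∀ n : ℕ, 1 ≤ n → n ≠ 2 → ωT n = 0) {n : ℕ}
    (p : Fin (n + 1)) (g : Fin (n + 2) → V) :
    ∑ P : Finpartition (Finset.univ : Finset (Fin (n + 2))) with
        {p.castSucc, p.succ} ∉ P.parts,
      ∏ r ∈ P.parts, blockValue ωT (g ∘ Equiv.swap p.castSucc p.succ) r =
    ∑ P : Finpartition (Finset.univ : Finset (Fin (n + 2))) with
        {p.castSucc, p.succ} ∉ P.parts,
      ∏ r ∈ P.parts, blockValue ωT g r := by
  set σ := Equiv.swap p.castSucc p.succ with hσ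
  have hinv : Function.Involutive σ := Equiv.swap_apply_self _ _
  have hpair : ({p.castSucc, p.succ} : Finset _).map σ.toEmbedding = {p.castSucc, p.succ} := by
    simp [Finset.map_insert, hσ, Finset.pair_comm]
  have hmaps (P : Finpartition (Finset.univ : Finset (Fin (n + 2))))
      (hP : P ∈ Finset.univ.filter fun P : Finpartition (Finset.univ : Finset (Fin (n + 2))) =>
        {p.castSucc, p.succ} ∉ P.parts) :
      P.permute σ ∈ Finset.univ.filter
        fun P : Finpartition (Finset.univ : Finset (Fin (n + 2))) =>
          {p.castSucc, p.succ} ∉ P.parts := by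
    simp only [Finset.mem_filter, Finset.mem_univ, true_and] at hP ⊢
    intro h
    rw [Finpartition.permute_parts] at h
    obtain ⟨r, hr, h⟩ := Finset.mem_map.1 h
    replace h : r.map σ.toEmbedding = _ := h
    rw [← hpair] at h
    rw [Finset.map_injective _ h] at hr
    exact hP hr
  refine Finset.sum_bij' (fun P _ => P.permute σ) (fun P _ => P.permute σ) hmaps hmaps
    (fun P _ => Finpartition.permute_permute_of_involutive hinv P)
    (fun P _ => Finpartition.permute_permute_of_involutive hinv P) ?_
  intro P hP
  rw [Finpartition.permute_parts, Finset.prod_map]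
  refine Finset.prod_congr rfl fun r hr => blockValue_comp_swap hqf p g ?_
  rintro rfl
  exact (Finset.mem_filter.1 hP).2 hr

theorem IsTruncatedFamily.sub_comp_swap (htr : IsTruncatedFamily ω ωT)
    (hω0 : ∀ v : Fin 0 → V, ω 0 v = 1) (hqf : ∀ n : ℕ, 1 ≤ n → n ≠ 2 → ωT n = 0) {n : ℕ}
    (p : Fin (n + 1)) (g : Fin (n + 2) → V) :
    ω (n + 2) g - ω (n + 2) (g ∘ Equiv.swap p.castSucc p.succ) =
      (ωT 2 ![g p.castSucc, g p.succ] - ωT 2 ![g p.succ, g p.castSucc]) * ω n (omitTwo g p) := by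
  have key (h : Fin (n + 2) → V) :
      ω (n + 2) h = ωT 2 ![h p.castSucc, h p.succ] * ω n (omitTwo h p) +
        ∑ P : Finpartition (Finset.univ : Finset (Fin (n + 2))) with
          {p.castSucc, p.succ} ∉ P.parts, ∏ r ∈ P.parts, blockValue ωT h r := by
    rw [htr.eq_sum_blockValue hω0 (n + 2), htr.eq_sum_blockValue hω0 n,
      ← Finset.sum_filter_add_sum_filter_not _ (fun P => {p.castSucc, p.succ} ∈ P.parts),
      Finpartition.sum_filter_mem_parts_prod (skipTwo p) _ _ (by simp)
        (mem_pair_iff_notMem_range_skipTwo p),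
      blockValue_pair ωT h Fin.castSucc_lt_succ, omitTwo_eq_comp_skipTwo]
    simp_rw [blockValue_map ωT h (skipTwo p) _ ((skipTwo_strictMono p).strictMonoOn _)]
  have homit : omitTwo (g ∘ Equiv.swap p.castSucc p.succ) p = omitTwo g p := by
    simp only [omitTwo_eq_comp_skipTwo]
    ext j
    have hj := mt (mem_pair_iff_notMem_range_skipTwo p (skipTwo p j)).1 (not_not.2 ⟨j, rfl⟩)
    simp only [Finset.mem_insert, Finset.mem_singleton, not_or] at hj
    simp only [Function.comp_apply, Equiv.swap_apply_of_ne_of_ne hj.1 hj.2]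
  rw [key g, key (g ∘ _), homit, sum_filter_notMem_parts_comp_swap hqf]
  simp only [Function.comp_apply, Equiv.swap_apply_left, Equiv.swap_apply_right]
  ring

end quasifree

/-- A quasi-free state (all truncated functionals with `n ≠ 2` vanish) satisfies scalar
commutation relations. -/
theorem quasifree_satisfiesSCR {V : Type*} [AddCommGroup V] [Module ℂ V]
    (ω ωT : ∀ n, MultilinearMap ℂ (fun _ : Fin n => V) ℂ)
    (hω0 : ∀ v : Fin 0 → V, ω 0 v = 1)
    (htr : IsTruncatedFamily ω ωT)
    (hqf : ∀ n : ℕ, 1 ≤ n → n ≠ 2 → ωT n = 0) :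
    SatisfiesScalarCommutationRelations ω := by
  intro n p g
  have hω2 (a b : V) : ω 2 ![a, b] - ω 2 ![b, a] = ωT 2 ![a, b] - ωT 2 ![b, a] := by
    have h := htr.sub_comp_swap hω0 hqf (0 : Fin 1) ![a, b]
    have hswap : ![a, b] ∘ Equiv.swap (0 : Fin 1).castSucc (0 : Fin 1).succ = ![b, a] := by
      ext j
      fin_cases j <;> simp
    rw [hω0, mul_one, hswap] at h
    exact h
  rw [hω2, htr.sub_comp_swap hω0 hqf]
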